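/- Let A = {(x, y) ∈ ℝ² : (x − y)² ≤ x + y ≤ 1}. There exist Borel measurable maps (x,y) ↦ P^{x,y} and (x,y) ↦ Q^{x,y} from A into the 2×2 real matrices such that for every (x, y) ∈ A, P^{x,y} and Q^{x,y} are one-dimensional orthogonal projections (symmetric idempotents of rank 1) and the diagonal entries of Q^{x,y} P^{x,y} are (Q^{x,y}P^{x,y})₁₁ = x and (Q^{x,y}P^{x,y})₂₂ = y. -/

import Mathlib

/-- The standard (Borel) measurable structure on `2×2` real matrices, i.e. the product
measurable structure obtained by viewing a matrix as a family of its entries. -/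
noncomputable instance : MeasurableSpace (Matrix (Fin 2) (Fin 2) ℝ) :=
  inferInstanceAs (MeasurableSpace (Fin 2 → Fin 2 → ℝ))

/-- The orthogonal projection of `ℝ²` onto the line at angle `t / 2` from the first axis. -/
noncomputable def lineProjection (t : ℝ) : Matrix (Fin 2) (Fin 2) ℝ :=
  !![(1 + Real.cos t) / 2, Real.sin t / 2; Real.sin t / 2, (1 - Real.cos t) / 2]

theorem measurable_lineProjection : Measurable lineProjection := by
  refine measurable_pi_iff.mpr fun i => measurable_pi_iff.mpr fun j => ?_
  fin_cases i <;> fin_cases j <;> simp [lineProjection] <;> fun_prop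

theorem lineProjection_transpose (t : ℝ) : (lineProjection t).transpose = lineProjection t := by
  ext i j
  fin_cases i <;> fin_cases j <;> simp [lineProjection]

theorem lineProjection_mul_self (t : ℝ) :
    lineProjection t * lineProjection t = lineProjection t := by
  have h := Real.sin_sq_add_cos_sq t
  ext i j
  fin_cases i <;> fin_cases j <;> simp [lineProjection, Matrix.mul_apply] <;> linarith

theorem lineProjection_trace (t : ℝ) : (lineProjection t).trace = 1 := by
  simp [lineProjection, Matrix.trace_fin_two]
  ring

theorem lineProjection_mul_apply_zero_zero (s d : ℝ) :
    (lineProjection (s - d) * lineProjection (s + d)) 0 0 =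
      (Real.cos d ^ 2 + Real.cos s * Real.cos d) / 2 := by
  simp [lineProjection, Matrix.mul_apply, Real.cos_add, Real.cos_sub, Real.sin_add, Real.sin_sub]
  linear_combination ((Real.cos d ^ 2 - Real.sin d ^ 2) / 4) * Real.sin_sq_add_cos_sq s -
    (1 / 4) * Real.sin_sq_add_cos_sq d

theorem lineProjection_mul_apply_one_one (s d : ℝ) :
    (lineProjection (s - d) * lineProjection (s + d)) 1 1 =
      (Real.cos d ^ 2 - Real.cos s * Real.cos d) / 2 := by
  simp [lineProjection, Matrix.mul_apply, Real.cos_add, Real.cos_sub, Real.sin_add, Real.sin_sub]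
  linear_combination ((Real.cos d ^ 2 - Real.sin d ^ 2) / 4) * Real.sin_sq_add_cos_sq s -
    (1 / 4) * Real.sin_sq_add_cos_sq d

theorem cos_arccos_sqrt {u : ℝ} (hu : u ≤ 1) :
    Real.cos (Real.arccos (√u)) = √u :=
  Real.cos_arccos (by linarith [Real.sqrt_nonneg u]) (Real.sqrt_le_one.mpr hu)

theorem cos_arccos_div_sqrt_mul {u v : ℝ} (h : v ^ 2 ≤ u) :
    Real.cos (Real.arccos (v / √u)) * √u = v := by
  have hv : |v| ≤ √u := Real.abs_le_sqrt h
  have hle : |v / √u| ≤ 1 := by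
    rw [abs_div, abs_of_nonneg (Real.sqrt_nonneg u)]
    exact div_le_one_of_le₀ hv (Real.sqrt_nonneg u)
  rw [Real.cos_arccos (abs_le.mp hle).1 (abs_le.mp hle).2]
  refine div_mul_cancel_of_imp fun h0 => ?_
  rwa [h0, abs_nonpos_iff] at hv

/-- On `A = {(x, y) : (x - y)² ≤ x + y ≤ 1}` there are Borel measurable maps
`(x,y) ↦ P^{x,y}`, `(x,y) ↦ Q^{x,y}` into the `2×2` real matrices such that each `P^{x,y}`,
`Q^{x,y}` is a one-dimensional orthogonal projection (symmetric idempotent with trace 1) and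
the diagonal entries of `Q^{x,y} P^{x,y}` are `x` and `y`. -/
theorem measurable_projection_selection :
    ∃ P Q : {p : ℝ × ℝ // (p.1 - p.2) ^ 2 ≤ p.1 + p.2 ∧ p.1 + p.2 ≤ 1} →
        Matrix (Fin 2) (Fin 2) ℝ,
      Measurable P ∧ Measurable Q ∧
      ∀ p, (P p).transpose = P p ∧ P p * P p = P p ∧ (P p).trace = 1 ∧
        (Q p).transpose = Q p ∧ Q p * Q p = Q p ∧ (Q p).trace = 1 ∧
        (Q p * P p) 0 0 = p.val.1 ∧ (Q p * P p) 1 1 = p.val.2 := by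
  let d : ℝ × ℝ → ℝ := fun p => Real.arccos (√(p.1 + p.2))
  let s : ℝ × ℝ → ℝ := fun p => Real.arccos ((p.1 - p.2) / √(p.1 + p.2))
  have hd : Measurable d := Real.measurable_arccos.comp (by fun_prop)
  have hs : Measurable s := Real.measurable_arccos.comp (by fun_prop)
  refine ⟨fun p => lineProjection (s p + d p), fun p => lineProjection (s p - d p),
    measurable_lineProjection.comp ((hs.add hd).comp measurable_subtype_coe),
    measurable_lineProjection.comp ((hs.sub hd).comp measurable_subtype_coe), ?_⟩
  rintro ⟨⟨x, y⟩, h, h1⟩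
  have hcd : Real.cos (d (x, y)) = √(x + y) := cos_arccos_sqrt h1
  have hcs : Real.cos (s (x, y)) * √(x + y) = x - y := cos_arccos_div_sqrt_mul h
  have hsq : √(x + y) ^ 2 = x + y := Real.sq_sqrt ((sq_nonneg _).trans h)
  refine ⟨lineProjection_transpose _, lineProjection_mul_self _, lineProjection_trace _,
    lineProjection_transpose _, lineProjection_mul_self _, lineProjection_trace _, ?_, ?_⟩
  · rw [lineProjection_mul_apply_zero_zero, hcd, hcs, hsq]
    ring
  · rw [lineProjection_mul_apply_one_one, hcd, hcs, hsq]
    ring
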